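/- arXiv:1109.5745 — 4 statements merged into one kernel-verified Lean document; each statement's English description precedes it below -/
import Mathlib

section
/- Let g be a 4×4 complex matrix. Then g is unitary and satisfies g J g* = J if and only if there exist 2×2 complex matrices A, B such that g is the block matrix [[A, B], [−B, A]] and both A + iB and A − iB are unitary 2×2 matrices. -/
open Matrix

noncomputable section

abbrev M2 := Matrix (Fin 2) (Fin 2) ℂ
abbrev M4 := Matrix (Fin 2 ⊕ Fin 2) (Fin 2 ⊕ Fin 2) ℂ

/-- The matrix `J = [[0, i·I₂], [−i·I₂, 0]]`. -/
def Jmat : M4 := fromBlocks 0 (Complex.I • 1) (-(Complex.I • 1)) 0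

theorem commute_Jmat_iff (g : M4) :
    g * Jmat = Jmat * g ↔ ∃ A B : M2, g = fromBlocks A B (-B) A := by
  constructor
  · intro h
    obtain ⟨A, B, C, D, rfl⟩ : ∃ A B C D, g = fromBlocks A B C D :=
      ⟨_, _, _, _, (fromBlocks_toBlocks g).symm⟩
    simp only [Jmat, fromBlocks_multiply, fromBlocks_inj, mul_zero, zero_mul, zero_add, add_zero,
      mul_neg, neg_mul, mul_smul_comm, smul_mul_assoc, mul_one, one_mul] at h
    obtain ⟨h₁, h₂, -, -⟩ := h
    rw [← smul_neg] at h₁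
    refine ⟨A, B, ?_⟩
    rw [smul_right_injective M2 Complex.I_ne_zero h₁, smul_right_injective M2 Complex.I_ne_zero h₂]
  · rintro ⟨A, B, rfl⟩
    simp [Jmat, fromBlocks_multiply]

theorem fromBlocks_mul_conjTranspose_eq_one_iff (A B : M2) :
    fromBlocks A B (-B) A * (fromBlocks A B (-B) A)ᴴ = 1 ↔
      A * Aᴴ + B * Bᴴ = 1 ∧ B * Aᴴ - A * Bᴴ = 0 := by
  rw [fromBlocks_conjTranspose, fromBlocks_multiply, ← fromBlocks_one, fromBlocks_inj]
  simp only [conjTranspose_neg, mul_neg, neg_mul, neg_neg]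
  constructor
  · rintro ⟨h₁, h₂, -, -⟩
    exact ⟨h₁, by rw [← h₂]; abel⟩
  · rintro ⟨h₁, h₂⟩
    exact ⟨h₁, by rw [← h₂]; abel, by rw [← neg_zero, ← h₂]; abel, by rw [← h₁]; abel⟩

theorem add_I_smul_mul_conjTranspose (A B : M2) :
    (A + Complex.I • B) * (A + Complex.I • B)ᴴ =
      A * Aᴴ + B * Bᴴ + Complex.I • (B * Aᴴ - A * Bᴴ) := by
  simp only [conjTranspose_add, conjTranspose_smul, Complex.star_def, Complex.conj_I, add_mul,
    mul_add, smul_mul_assoc, mul_smul_comm, smul_smul, Complex.I_mul_I,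
    mul_neg, smul_sub, smul_add, neg_smul, one_smul]
  abel

theorem sub_I_smul_mul_conjTranspose (A B : M2) :
    (A - Complex.I • B) * (A - Complex.I • B)ᴴ =
      A * Aᴴ + B * Bᴴ - Complex.I • (B * Aᴴ - A * Bᴴ) := by
  have h := add_I_smul_mul_conjTranspose A (-B)
  simp only [smul_neg, ← sub_eq_add_neg, conjTranspose_neg, neg_mul, mul_neg, neg_neg] at h
  rw [h, sub_eq_add_neg _ (Complex.I • _), ← smul_neg]
  congr 2
  abel

theorem add_eq_and_sub_eq_iff (X Y Z : M2) :
    X + Complex.I • Y = Z ∧ X - Complex.I • Y = Z ↔ X = Z ∧ Y = 0 := by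
  constructor
  · rintro ⟨h₁, h₂⟩
    have hY : Complex.I • Y = 0 := by
      have h : (2 : ℂ) • Complex.I • Y = 0 := by
        rw [two_smul, ← sub_self Z]
        nth_rw 1 [← h₁]
        rw [← h₂]
        abel
      exact (smul_eq_zero.mp h).resolve_left two_ne_zero
    exact ⟨by rwa [hY, add_zero] at h₁, (smul_eq_zero.mp hY).resolve_left Complex.I_ne_zero⟩
  · rintro ⟨rfl, rfl⟩
    simp

/-- A 4×4 complex matrix `g` is unitary and satisfies `g J g* = J` iff it has the block
form `[[A, B], [−B, A]]` with both `A + iB` and `A − iB` unitary. -/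
theorem stmt0 (g : M4) :
    (g * gᴴ = 1 ∧ g * Jmat * gᴴ = Jmat) ↔
    ∃ A B : M2, g = fromBlocks A B (-B) A ∧
      (A + Complex.I • B) * (A + Complex.I • B)ᴴ = 1 ∧
      (A - Complex.I • B) * (A - Complex.I • B)ᴴ = 1 := by
  have hJ (hg : g * gᴴ = 1) : g * Jmat * gᴴ = Jmat ↔ g * Jmat = Jmat * g := by
    constructor
    · intro h
      calc g * Jmat = g * Jmat * (gᴴ * g) := by rw [mul_eq_one_comm.mp hg, mul_one]
        _ = Jmat * g := by rw [← mul_assoc, h]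
    · intro h
      rw [h, mul_assoc, hg, mul_one]
  rw [and_congr_right hJ, commute_Jmat_iff]
  simp only [add_I_smul_mul_conjTranspose, sub_I_smul_mul_conjTranspose, add_eq_and_sub_eq_iff,
    ← fromBlocks_mul_conjTranspose_eq_one_iff]
  constructor
  · rintro ⟨hg, A, B, rfl⟩
    exact ⟨A, B, rfl, hg⟩
  · rintro ⟨A, B, rfl, hg⟩
    exact ⟨hg, A, B, rfl⟩
end
end

section
/- Let g = [[A, B], [C, D]] (in 2×2 blocks) be a 4×4 complex matrix satisfying g J g* = J. Then both A − iC and A + iC are invertible 2×2 matrices. -/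
open Matrix

noncomputable section

theorem Jmat_mul_self : Jmat * Jmat = 1 := by
  simp [Jmat, fromBlocks_multiply, smul_smul]

/-- The relation `g J g* = J` is equivalent to `g* J g = J`. -/
theorem conjTranspose_mul_Jmat_mul {g : M4} (h : g * Jmat * gᴴ = Jmat) :
    gᴴ * Jmat * g = Jmat := by
  have h₁ : g * (Jmat * gᴴ * Jmat) = 1 := by
    rw [← Jmat_mul_self, ← mul_assoc, ← mul_assoc, h]
  have h₂ := mul_eq_one_comm.mp h₁
  calc gᴴ * Jmat * g = Jmat * Jmat * (gᴴ * Jmat * g) := by rw [Jmat_mul_self, one_mul]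
    _ = Jmat * (Jmat * gᴴ * Jmat * g) := by simp only [mul_assoc]
    _ = Jmat := by rw [h₂, mul_one]

open scoped ComplexOrder in
/-- If `M* M = A* A + C* C` and the column `(A; C)` has a left inverse, then `M` is invertible. -/
theorem isUnit_of_conjTranspose_mul_self_eq_add {n : Type*} [Fintype n] [DecidableEq n]
    {A C M P Q : Matrix n n ℂ} (hM : Mᴴ * M = Aᴴ * A + Cᴴ * C) (hPQ : P * A + Q * C = 1) :
    IsUnit M := by
  rw [← mulVec_injective_iff_isUnit, ← coe_mulVecLin, ← LinearMap.ker_eq_bot,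
    LinearMap.ker_eq_bot']
  intro v hv
  rw [mulVecLin_apply, ← conjTranspose_mul_self_mulVec_eq_zero, hM,
    ← fromCols_mul_fromRows, ← conjTranspose_fromRows_eq_fromCols_conjTranspose,
    conjTranspose_mul_self_mulVec_eq_zero, fromRows_mulVec] at hv
  have hA : A *ᵥ v = 0 := funext fun i => congrFun hv (Sum.inl i)
  have hC : C *ᵥ v = 0 := funext fun i => congrFun hv (Sum.inr i)
  rw [← one_mulVec v, ← hPQ, add_mulVec, ← mulVec_mulVec, ← mulVec_mulVec, hA, hC]
  simp

/-- If `g = [[A, B], [C, D]]` satisfies `g J g* = J`, then `A − iC` and `A + iC` are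
invertible. -/
theorem stmt2 (A B C D : M2)
    (h : fromBlocks A B C D * Jmat * (fromBlocks A B C D)ᴴ = Jmat) :
    IsUnit (A - Complex.I • C) ∧ IsUnit (A + Complex.I • C) := by
  have hJ := conjTranspose_mul_Jmat_mul h
  rw [Jmat, fromBlocks_conjTranspose, fromBlocks_multiply, fromBlocks_multiply,
    fromBlocks_inj] at hJ
  obtain ⟨h₁₁, -, h₂₁, -⟩ := hJ
  have hAC : Cᴴ * A = Aᴴ * C := by
    have := congrArg (Complex.I • ·) h₁₁
    simp [smul_smul, smul_add] at this
    linear_combination (norm := module) this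
  have hinv : Dᴴ * A + (-Bᴴ) * C = 1 := by
    have := congrArg (Complex.I • ·) h₂₁
    simp [smul_smul, smul_add] at this
    rw [neg_mul]
    linear_combination (norm := module) this
  constructor <;> refine isUnit_of_conjTranspose_mul_self_eq_add ?_ hinv
  · simp [add_mul, mul_sub, smul_smul, hAC]
    abel
  · simp [add_mul, mul_add, smul_smul, hAC]
end
end

section
/- Let x₁, x₂, x₃, x₄ ∈ ℝ and set Y = [[x₄ + x₃, x₁ + i·x₂], [x₁ − i·x₂, x₄ − x₃]]. Let Q denote the map W ↦ (I + iW)(I − iW)⁻¹ on 2×2 complex matrices (I − iY is invertible since Y is Hermitian). Then for every Hermitian 2×2 complex matrix v, −det( Q(Y)⁻¹ · (DQ)_Y(v) ) = 4·( 1 + 2(x₁² + x₂² + x₃² + x₄²) + (x₄² − x₁² − x₂² − x₃²)² )⁻¹ · det v, where (DQ)_Y(v) denotes the Fréchet derivative of Q at Y applied to v. (This says the Cayley embedding of Minkowski space ℝ^{1,3} into U(2) is conformal with conformal factor 4(1 + 2Σxᵢ² + (x,x)²)⁻¹, since det v is the Minkowski square norm of the vector corresponding to the Hermitian matrix v.)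 -/
open Matrix

noncomputable section

attribute [local instance] Matrix.normedAddCommGroup Matrix.normedSpace

/-- The map `Q : W ↦ (I + iW)(I − iW)⁻¹` on 2×2 complex matrices. -/
def Qc (W : M2) : M2 := (1 + Complex.I • W) * (1 - Complex.I • W)⁻¹

/-- The Hermitian matrix of Minkowski coordinates
`[[x₄ + x₃, x₁ + i·x₂], [x₁ − i·x₂, x₄ − x₃]]`. -/
def mink (x₁ x₂ x₃ x₄ : ℝ) : M2 :=
  !![(x₄ : ℂ) + (x₃ : ℂ), (x₁ : ℂ) + (x₂ : ℂ) * Complex.I;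
     (x₁ : ℂ) - (x₂ : ℂ) * Complex.I, (x₄ : ℂ) - (x₃ : ℂ)]

theorem fderiv_cayley_apply {R : Type*} [NormedRing R] [NormedAlgebra ℂ R] [CompleteSpace R]
    (Y v : R) (u : Rˣ) (hu : (u : R) = 1 - Complex.I • Y) :
    fderiv ℂ (fun W : R => (1 + Complex.I • W) * Ring.inverse (1 - Complex.I • W)) Y v =
      (2 * Complex.I) • ((↑u⁻¹ : R) * v * ↑u⁻¹) := by
  have h1 : HasFDerivAt (fun W : R => 1 + Complex.I • W)
      (Complex.I • ContinuousLinearMap.id ℂ R) Y :=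
    ((hasFDerivAt_id Y).const_smul Complex.I).const_add 1
  have h2 : HasFDerivAt (fun W : R => 1 - Complex.I • W)
      (-(Complex.I • ContinuousLinearMap.id ℂ R)) Y :=
    ((hasFDerivAt_id Y).const_smul Complex.I).const_sub 1
  have h3 := hasFDerivAt_ringInverse (𝕜 := ℂ) u
  rw [hu] at h3
  have h4 := h1.mul' (h3.comp Y h2)
  have hY : 1 + Complex.I • Y = 2 - (u : R) := by rw [hu, ← one_add_one_eq_two]; abel
  refine (congrArg (fun L : R →L[ℂ] R => L v) h4.fderiv).trans ?_
  simp [← hu, hY, sub_mul, mul_assoc, two_mul]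
  module

theorem fderiv_Qc_apply (Y v : M2) (hY : IsUnit (1 - Complex.I • Y)) :
    fderiv ℂ Qc Y v =
      (2 * Complex.I) • ((1 - Complex.I • Y)⁻¹ * v * (1 - Complex.I • Y)⁻¹) := by
  obtain ⟨u, hu⟩ := hY
  have hQ : Qc = fun W : M2 => (1 + Complex.I • W) * Ring.inverse (1 - Complex.I • W) := by
    funext W
    rw [Qc, nonsing_inv_eq_ringInverse]
  rw [hQ, ← hu, nonsing_inv_eq_ringInverse, Ring.inverse_unit]
  exact @fderiv_cayley_apply M2 Matrix.linftyOpNormedRing Matrix.linftyOpNormedAlgebra inferInstance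
    Y v u hu

theorem det_one_sub_mul_det_one_add_mink (x₁ x₂ x₃ x₄ : ℝ) :
    (1 - Complex.I • mink x₁ x₂ x₃ x₄).det * (1 + Complex.I • mink x₁ x₂ x₃ x₄).det =
      ((1 + 2 * (x₁ ^ 2 + x₂ ^ 2 + x₃ ^ 2 + x₄ ^ 2)
          + (x₄ ^ 2 - x₁ ^ 2 - x₂ ^ 2 - x₃ ^ 2) ^ 2 : ℝ) : ℂ) := by
  have hI : Complex.I ^ 2 = -1 := Complex.I_sq
  have hI4 : Complex.I ^ 4 = 1 := Complex.I_pow_four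
  simp only [mink, det_fin_two, Matrix.sub_apply, Matrix.add_apply, Matrix.smul_apply, one_apply, of_apply, cons_val',
    cons_val_zero, cons_val_one, smul_eq_mul, Fin.isValue]
  push_cast
  norm_num
  grind

/-- The Cayley embedding of Minkowski space into `U(2)` is conformal: for every Hermitian
`v`, `−det(Q(Y)⁻¹·(DQ)_Y(v)) = 4(1 + 2Σxᵢ² + (x,x)²)⁻¹·det v` where `Y = mink x₁ x₂ x₃ x₄`. -/
theorem stmt6 (x₁ x₂ x₃ x₄ : ℝ) (v : M2) (hv : vᴴ = v) :
    -((Qc (mink x₁ x₂ x₃ x₄))⁻¹ * fderiv ℂ Qc (mink x₁ x₂ x₃ x₄) v).det =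
      ((4 * (1 + 2 * (x₁ ^ 2 + x₂ ^ 2 + x₃ ^ 2 + x₄ ^ 2)
          + (x₄ ^ 2 - x₁ ^ 2 - x₂ ^ 2 - x₃ ^ 2) ^ 2)⁻¹ : ℝ) : ℂ) * v.det := by
  have hdet := det_one_sub_mul_det_one_add_mink x₁ x₂ x₃ x₄
  have hpos : (1 + 2 * (x₁ ^ 2 + x₂ ^ 2 + x₃ ^ 2 + x₄ ^ 2)
      + (x₄ ^ 2 - x₁ ^ 2 - x₂ ^ 2 - x₃ ^ 2) ^ 2 : ℝ) ≠ 0 := by positivity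
  rw [Complex.ofReal_mul, Complex.ofReal_inv, ← hdet]
  rw [← Complex.ofReal_ne_zero, ← hdet] at hpos
  generalize mink x₁ x₂ x₃ x₄ = Y at hpos ⊢
  obtain ⟨hA, hB⟩ := mul_ne_zero_iff.1 hpos
  rw [fderiv_Qc_apply Y v ((isUnit_iff_isUnit_det _).2 hA.isUnit)]
  simp only [Qc, det_mul, det_smul, det_nonsing_inv, Ring.inverse_eq_inv', Fintype.card_fin,
    mul_pow, Complex.I_sq, Complex.ofReal_ofNat]
  field_simp
  ring
end
end

section
/- Let g = [[A, B], [C, D]] (in 2×2 blocks) be a 4×4 complex matrix with g I_{2,2} g* = I_{2,2}, and let Z be a 2×2 unitary matrix. Then C·Z + D is invertible and (A·Z + B)(C·Z + D)⁻¹ is a 2×2 unitary matrix. (Hence the linear fractional action of U(2,2) on U(2) is well defined.) -/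
open Matrix

noncomputable section

/-- The matrix `I_{2,2} = diag(1, 1, −1, −1)`. -/
def I22 : M4 := fromBlocks 1 0 0 (-1)

lemma I22_mul_self : I22 * I22 = 1 := by
  simp [I22, fromBlocks_multiply]

/-- The form `I_{2,2}` is preserved by `g` on the left as soon as it is on the right. -/
lemma conjTranspose_mul_I22_mul {g : M4} (hg : g * I22 * gᴴ = I22) : gᴴ * I22 * g = I22 := by
  have h : g * (I22 * gᴴ * I22) = 1 := by
    rw [← I22_mul_self, ← mul_assoc, ← mul_assoc, hg]
  have h' : I22 * gᴴ * I22 * g = 1 := mul_eq_one_comm.mp h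
  calc gᴴ * I22 * g = I22 * I22 * (gᴴ * I22 * g) := by rw [I22_mul_self, one_mul]
    _ = I22 * (I22 * gᴴ * I22 * g) := by simp only [mul_assoc]
    _ = I22 := by rw [h', mul_one]

/-- The block identities expressing `g* I_{2,2} g = I_{2,2}`. -/
lemma block_relations {A B C D : M2}
    (hg : fromBlocks A B C D * I22 * (fromBlocks A B C D)ᴴ = I22) :
    Aᴴ * A - Cᴴ * C = 1 ∧ Aᴴ * B - Cᴴ * D = 0 ∧
      Bᴴ * A - Dᴴ * C = 0 ∧ Bᴴ * B - Dᴴ * D = -1 := by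
  have h := conjTranspose_mul_I22_mul hg
  simpa [I22, fromBlocks_conjTranspose, fromBlocks_multiply, fromBlocks_inj, sub_eq_add_neg]
    using h

/-- If `g = [[A, B], [C, D]]` satisfies `g I_{2,2} g* = I_{2,2}` and `Z` is unitary, then
`C·Z + D` is invertible and `(A·Z + B)(C·Z + D)⁻¹` is unitary. -/
theorem stmt7 (A B C D Z : M2)
    (hg : fromBlocks A B C D * I22 * (fromBlocks A B C D)ᴴ = I22)
    (hZ : Z * Zᴴ = 1) :
    IsUnit (C * Z + D) ∧
    ((A * Z + B) * (C * Z + D)⁻¹) * ((A * Z + B) * (C * Z + D)⁻¹)ᴴ = 1 := by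
  obtain ⟨hAA, hAB, hBA, hBB⟩ := block_relations hg
  have hZ' : Zᴴ * Z = 1 := mul_eq_one_comm.mp hZ
  set N := A * Z + B with hN
  set M := C * Z + D with hM
  have hA : Aᴴ * N - Cᴴ * M = Z := by
    calc Aᴴ * N - Cᴴ * M = (Aᴴ * A - Cᴴ * C) * Z + (Aᴴ * B - Cᴴ * D) := by
          rw [hN, hM]; noncomm_ring
      _ = Z := by rw [hAA, hAB, one_mul, add_zero]
  have hB : Bᴴ * N - Dᴴ * M = -1 := by
    calc Bᴴ * N - Dᴴ * M = (Bᴴ * A - Dᴴ * C) * Z + (Bᴴ * B - Dᴴ * D) := by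
          rw [hN, hM]; noncomm_ring
      _ = -1 := by rw [hBA, hBB, zero_mul, zero_add]
  have hNM : Nᴴ * N = Mᴴ * M := by
    rw [← sub_eq_zero]
    calc Nᴴ * N - Mᴴ * M = Zᴴ * (Aᴴ * N - Cᴴ * M) + (Bᴴ * N - Dᴴ * M) := by
          nth_rw 1 [hN, hM]
          simp only [conjTranspose_add, conjTranspose_mul]
          noncomm_ring
      _ = 0 := by rw [hA, hB, hZ', add_neg_cancel]
  have hunit : IsUnit M := by
    rw [← mulVec_injective_iff_isUnit, ← coe_mulVecLin, ← LinearMap.ker_eq_bot,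
      LinearMap.ker_eq_bot']
    intro v hv
    rw [mulVecLin_apply] at hv
    have hNv : N *ᵥ v = 0 := by
      open scoped ComplexOrder in
      rw [← conjTranspose_mul_self_mulVec_eq_zero, hNM, ← mulVec_mulVec, hv, mulVec_zero]
    have h := congrArg (· *ᵥ v) hB
    simpa [sub_mulVec, ← mulVec_mulVec, hv, hNv, neg_mulVec] using h
  refine ⟨hunit, mul_eq_one_comm.mp ?_⟩
  have hdet : IsUnit M.det := (isUnit_iff_isUnit_det M).mp hunit
  calc (N * M⁻¹)ᴴ * (N * M⁻¹) = M⁻¹ᴴ * (Nᴴ * N) * M⁻¹ := by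
        rw [conjTranspose_mul]; simp only [mul_assoc]
    _ = (M * M⁻¹)ᴴ * (M * M⁻¹) := by
        rw [hNM, conjTranspose_mul]; simp only [mul_assoc]
    _ = 1 := by rw [mul_nonsing_inv M hdet, conjTranspose_one, one_mul]
end
end
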